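/- arXiv:2007.11792 — 2 statements merged into one kernel-verified Lean document; each statement's English description precedes it below -/
import Mathlib

section
/- Let σ > 0 be a constant with σ ≠ 2, and let u, v be a real-valued classical solution of the Goldstein–Taylor system ∂ₜu + ∂ₓv = 0, ∂ₜv + ∂ₓu = −σ v on 𝕋 × (0,∞) with initial data u₀, v₀, and set u_avg := (u₀)_avg. Define θ(σ) := σ if 0 < σ < 2 and θ(σ) := 4/σ if σ > 2, and μ(σ) := σ/2 if 0 < σ < 2 and μ(σ) := σ/2 − √(σ²/4 − 1) if σ > 2. Then for all t ≥ 0: E_{θ(σ)}(u(·,t) − u_avg, v(·,t)) ≤ E_{θ(σ)}(u₀ − u_avg, v₀) · e^{−2μ(σ)t}. -/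
open MeasureTheory Real

/-- Average of a (2π-periodic) function over one period. -/
noncomputable def havg (h : ℝ → ℝ) : ℝ := (1 / (2 * π)) * ∫ x in (0:ℝ)..(2 * π), h x

/-- Squared L²(𝕋) norm (normalized). -/
noncomputable def nsq (h : ℝ → ℝ) : ℝ := (1 / (2 * π)) * ∫ x in (0:ℝ)..(2 * π), (h x) ^ 2

/-- The anti-derivative ∂ₓ⁻¹ f with zero average. -/
noncomputable def antider (f : ℝ → ℝ) : ℝ → ℝ := fun x =>
  (∫ y in (0:ℝ)..x, f y) - havg (fun z => ∫ y in (0:ℝ)..z, f y)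

/-- The entropy functional E_θ(f,g). -/
noncomputable def entropyE (θ : ℝ) (f g : ℝ → ℝ) : ℝ :=
  nsq f + nsq g - (θ / (2 * π)) * ∫ x in (0:ℝ)..(2 * π), antider f x * g x

open Set intervalIntegral

/-- Differentiation under an interval integral with a positive parameter. -/
theorem hasDerivAt_intervalIntegral_of_continuousOn {f f' : ℝ → ℝ → ℝ} (a b : ℝ)
    (hf : ∀ t, Continuous (f t)) (hf' : ContinuousOn (Function.uncurry f') (Ioi 0 ×ˢ univ))
    (h : ∀ t, 0 < t → ∀ x, HasDerivAt (fun s => f s x) (f' t x) t) {t : ℝ} (ht : 0 < t) :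
    HasDerivAt (fun s => ∫ x in a..b, f s x) (∫ x in a..b, f' t x) t := by
  have hK : IsCompact (Icc (t / 2) (2 * t) ×ˢ uIcc a b) := isCompact_Icc.prod isCompact_uIcc
  obtain ⟨C, hC⟩ := hK.exists_bound_of_continuousOn (hf'.mono fun p hp =>
    ⟨mem_Ioi.2 ((half_pos ht).trans_le hp.1.1), mem_univ _⟩)
  have hcont : Continuous (f' t) := by
    rw [← continuousOn_univ]
    exact hf'.comp (by fun_prop : Continuous fun x : ℝ => (t, x)).continuousOn
      fun x _ => ⟨ht, mem_univ _⟩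
  refine (hasDerivAt_integral_of_dominated_loc_of_deriv_le (s := Icc (t / 2) (2 * t))
    (bound := fun _ => C) (Icc_mem_nhds (by linarith) (by linarith))
    (.of_forall fun s => (hf s).aestronglyMeasurable) ((hf t).intervalIntegrable _ _)
    hcont.aestronglyMeasurable (.of_forall fun x hx s hs => ?_) (by simp)
    (.of_forall fun x hx s hs => h s (by linarith [hs.1]) x)).2
  exact hC (s, x) ⟨hs, uIoc_subset_uIcc hx⟩

/-- Wirtinger's inequality on `[0, 2π]`. -/
theorem integral_sq_le_integral_deriv_sq {F f : ℝ → ℝ} (hf : Continuous f)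
    (hF : ∀ x, HasDerivAt F (f x) x) (hper : F (2 * π) = F 0)
    (hmean : ∫ x in (0 : ℝ)..(2 * π), F x = 0) :
    ∫ x in (0 : ℝ)..(2 * π), F x ^ 2 ≤ ∫ x in (0 : ℝ)..(2 * π), f x ^ 2 := by
  have hpi : (0 : ℝ) < 2 * π := two_pi_pos
  have hFc : Continuous F := continuous_iff_continuousAt.2 fun x => (hF x).continuousAt
  have hL {g : ℝ → ℝ} (hg : Continuous g) :
      MemLp (fun x => (g x : ℂ)) 2 (volume.restrict (Ioc 0 (2 * π))) := by
    have : Continuous fun x => (g x : ℂ) := by fun_prop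
    obtain ⟨C, hC⟩ := (isCompact_Icc (a := 0) (b := 2 * π)).exists_bound_of_continuousOn
      this.continuousOn
    exact .of_bound this.aestronglyMeasurable C <| (ae_restrict_iff' measurableSet_Ioc).2 <|
      .of_forall fun x hx => hC x (Ioc_subset_Icc_self hx)
  have hle : ∀ n : ℤ, ‖fourierCoeffOn hpi (fun x => (F x : ℂ)) n‖ ^ 2 ≤
      ‖fourierCoeffOn hpi (fun x => (f x : ℂ)) n‖ ^ 2 := by
    intro n
    rcases eq_or_ne n 0 with rfl | hn
    · have : fourierCoeffOn hpi (fun x => (F x : ℂ)) 0 = 0 := by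
        rw [fourierCoeffOn_eq_integral]
        simp [integral_ofReal, hmean]
      rw [this]
      simp
    · have hc := fourierCoeffOn_of_hasDerivAt hpi hn (f := fun x => (F x : ℂ))
        (f' := fun x => (f x : ℂ)) (fun x _ => (hF x).ofReal_comp)
        ((by fun_prop : Continuous fun x => (f x : ℂ)).intervalIntegrable _ _)
      have hn1 : (1 : ℝ) ≤ |(n : ℝ)| := by exact_mod_cast Int.one_le_abs hn
      have hnorm : ‖fourierCoeffOn hpi (fun x => (F x : ℂ)) n‖ =
          |(n : ℝ)|⁻¹ * ‖fourierCoeffOn hpi (fun x => (f x : ℂ)) n‖ := by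
        rw [hc, hper]
        simp [abs_of_pos pi_pos]
        field_simp
      rw [hnorm]
      gcongr
      exact mul_le_of_le_one_left (norm_nonneg _) (inv_le_one_of_one_le₀ hn1)
  have := hasSum_le hle (hasSum_sq_fourierCoeffOn hpi (hL hFc))
    (hasSum_sq_fourierCoeffOn hpi (hL hf))
  simp only [Complex.norm_real, norm_eq_abs, sq_abs, smul_eq_mul, sub_zero] at this
  exact le_of_mul_le_mul_left this (inv_pos.2 hpi)

/-- Grönwall's inequality for a linear differential inequality on `[0, ∞)`. -/
theorem le_mul_exp_of_deriv_le {y y' : ℝ → ℝ} {k : ℝ} (hy : ContinuousOn y (Ici 0))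
    (hd : ∀ t, 0 < t → HasDerivAt y (y' t) t) (hle : ∀ t, 0 < t → y' t ≤ -k * y t)
    {t : ℝ} (ht : 0 ≤ t) : y t ≤ y 0 * exp (-k * t) := by
  have hder : ∀ s, 0 < s →
      HasDerivAt (fun s => y s * exp (k * s)) ((y' s + k * y s) * exp (k * s)) s := by
    intro s hs
    refine ((hd s hs).fun_mul ((hasDerivAt_id' s).const_mul k).exp).congr_deriv ?_
    ring
  have hanti : AntitoneOn (fun s => y s * exp (k * s)) (Ici 0) := by
    refine antitoneOn_of_deriv_nonpos (convex_Ici 0) (hy.mul (by fun_prop)) ?_ ?_ <;>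
      rw [interior_Ici]
    · exact fun s hs => (hder s hs).differentiableAt.differentiableWithinAt
    · intro s hs
      rw [(hder s hs).deriv]
      exact mul_nonpos_of_nonpos_of_nonneg (by linarith [hle s hs]) (exp_pos _).le
  have h := hanti self_mem_Ici ht ht
  simp only [mul_zero, exp_zero, mul_one] at h
  rw [neg_mul, exp_neg, ← div_eq_mul_inv, le_div_iff₀ (exp_pos _)]
  exact h

/-- A periodic solution `(w, v)` of the Goldstein–Taylor system with constant relaxation `σ`, whose
first component has mean zero at time `0`. The functions `wx`, `vx` are the space derivatives. -/
structure IsCenteredGoldsteinTaylor (σ : ℝ) (w v wx vx : ℝ → ℝ → ℝ) : Prop where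
  continuous_w : Continuous (Function.uncurry w)
  continuous_v : Continuous (Function.uncurry v)
  continuousOn_wx : ContinuousOn (Function.uncurry wx) (Ioi 0 ×ˢ univ)
  continuousOn_vx : ContinuousOn (Function.uncurry vx) (Ioi 0 ×ˢ univ)
  hasDerivAt_w_space : ∀ t, 0 < t → ∀ x, HasDerivAt (w t) (wx t x) x
  hasDerivAt_v_space : ∀ t, 0 < t → ∀ x, HasDerivAt (v t) (vx t x) x
  hasDerivAt_w_time : ∀ t, 0 < t → ∀ x, HasDerivAt (fun s => w s x) (-vx t x) t
  hasDerivAt_v_time : ∀ t, 0 < t → ∀ x, HasDerivAt (fun s => v s x) (-wx t x - σ * v t x) t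
  periodic_w : ∀ t, w t (2 * π) = w t 0
  periodic_v : ∀ t, v t (2 * π) = v t 0
  integral_w_zero : ∫ x in (0 : ℝ)..(2 * π), w 0 x = 0

/-- The primitive in space vanishing at `0`. -/
noncomputable def spacePrimitive (w : ℝ → ℝ → ℝ) (t x : ℝ) : ℝ := ∫ y in (0 : ℝ)..x, w t y

theorem continuous_spacePrimitive {w : ℝ → ℝ → ℝ} (hw : Continuous (Function.uncurry w)) :
    Continuous (Function.uncurry (spacePrimitive w)) :=
  continuous_parametric_intervalIntegral_of_continuous (f := fun (p : ℝ × ℝ) y => w p.1 y)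
    (s := fun p => p.2)
    (hw.comp (by fun_prop : Continuous fun q : (ℝ × ℝ) × ℝ => (q.1.1, q.2))) continuous_snd

theorem integral_antider_mul {f g : ℝ → ℝ} (hf : Continuous f) (hg : Continuous g) :
    ∫ x in (0 : ℝ)..(2 * π), antider f x * g x =
      (∫ x in (0 : ℝ)..(2 * π), (∫ y in (0 : ℝ)..x, f y) * g x) -
        1 / (2 * π) * (∫ x in (0 : ℝ)..(2 * π), ∫ y in (0 : ℝ)..x, f y) *
          ∫ x in (0 : ℝ)..(2 * π), g x := by
  have hF : Continuous fun x => ∫ y in (0 : ℝ)..x, f y :=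
    continuous_primitive (fun a b => hf.intervalIntegrable a b) 0
  simp only [antider, sub_mul]
  rw [intervalIntegral.integral_sub, intervalIntegral.integral_const_mul]
  · rfl
  all_goals exact Continuous.intervalIntegrable (by fun_prop) _ _

/-- Young's inequality combined with Wirtinger's inequality for the mixed term of the entropy. -/
theorem entropy_quadratic_nonneg {f g : ℝ → ℝ} (hf : Continuous f) (hg : Continuous g)
    (hmean : ∫ x in (0 : ℝ)..(2 * π), f x = 0) (r : ℝ) :
    0 ≤ (∫ x in (0 : ℝ)..(2 * π), f x ^ 2) -
      2 * r * (∫ x in (0 : ℝ)..(2 * π), antider f x * g x) +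
      r ^ 2 * ∫ x in (0 : ℝ)..(2 * π), g x ^ 2 := by
  have hd : ∀ x, HasDerivAt (antider f) (f x) x := fun x =>
    (integral_hasDerivAt_right (hf.intervalIntegrable _ _)
      (hf.stronglyMeasurableAtFilter _ _) hf.continuousAt).sub_const _
  have hF : Continuous (antider f) := continuous_iff_continuousAt.2 fun x => (hd x).continuousAt
  have hW := integral_sq_le_integral_deriv_sq hf hd (by simp [antider, hmean]) (by
    have := integral_antider_mul hf (continuous_const (y := (1 : ℝ)))
    simp only [mul_one, intervalIntegral.integral_const, sub_zero, smul_eq_mul] at this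
    rw [this]
    field_simp
    ring)
  have hsq : 0 ≤ ∫ x in (0 : ℝ)..(2 * π), (antider f x - r * g x) ^ 2 :=
    integral_nonneg two_pi_pos.le fun x _ => sq_nonneg _
  have hexp : ∫ x in (0 : ℝ)..(2 * π), (antider f x - r * g x) ^ 2 =
      (∫ x in (0 : ℝ)..(2 * π), antider f x ^ 2) -
      2 * r * (∫ x in (0 : ℝ)..(2 * π), antider f x * g x) +
      r ^ 2 * ∫ x in (0 : ℝ)..(2 * π), g x ^ 2 := by
    rw [← intervalIntegral.integral_const_mul, ← intervalIntegral.integral_const_mul,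
      ← intervalIntegral.integral_sub, ← intervalIntegral.integral_add]
    · exact intervalIntegral.integral_congr fun x _ => by ring
    all_goals exact Continuous.intervalIntegrable (by fun_prop) _ _
  linarith

namespace IsCenteredGoldsteinTaylor

variable {σ : ℝ} {w v wx vx : ℝ → ℝ → ℝ}

theorem integral_w_eq_zero (h : IsCenteredGoldsteinTaylor σ w v wx vx) {t : ℝ} (ht : 0 ≤ t) :
    ∫ x in (0 : ℝ)..(2 * π), w t x = 0 := by
  have hw (t) : Continuous (w t) := h.continuous_w.comp (Continuous.prodMk_right t)
  have hvx (t) (ht : 0 < t) : Continuous (vx t) := continuousOn_univ.1 <|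
    h.continuousOn_vx.comp (Continuous.prodMk_right t).continuousOn fun x _ => ⟨ht, mem_univ _⟩
  have hd : ∀ t, 0 < t → HasDerivAt (fun s => ∫ x in (0 : ℝ)..(2 * π), w s x) 0 t := by
    intro t ht
    refine (hasDerivAt_intervalIntegral_of_continuousOn 0 (2 * π) hw
      (f' := fun t x => -vx t x) h.continuousOn_vx.neg h.hasDerivAt_w_time ht).congr_deriv ?_
    rw [intervalIntegral.integral_neg, integral_eq_sub_of_hasDerivAt
      (fun x _ => h.hasDerivAt_v_space t ht x) ((hvx t ht).intervalIntegrable _ _),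
      h.periodic_v, sub_self, neg_zero]
  have hc : Continuous fun s => ∫ x in (0 : ℝ)..(2 * π), w s x :=
    continuous_parametric_intervalIntegral_of_continuous' h.continuous_w _ _
  have h1 := le_mul_exp_of_deriv_le (k := 0) hc.continuousOn hd (by simp) ht
  have h2 := le_mul_exp_of_deriv_le (k := 0) hc.neg.continuousOn
    (fun t ht => (hd t ht).neg) (by simp) ht
  simp only [h.integral_w_zero, Pi.neg_apply] at h1 h2
  linarith

theorem entropyE_continuous (h : IsCenteredGoldsteinTaylor σ w v wx vx) (θ : ℝ) :
    Continuous fun t => entropyE θ (w t) (v t) := by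
  have hw (t) : Continuous (w t) := h.continuous_w.comp (Continuous.prodMk_right t)
  have hv (t) : Continuous (v t) := h.continuous_v.comp (Continuous.prodMk_right t)
  have hG := continuous_spacePrimitive h.continuous_w
  simp only [entropyE, nsq, integral_antider_mul (hw _) (hv _)]
  have c1 := continuous_parametric_intervalIntegral_of_continuous' (μ := volume)
    (f := fun t x => w t x ^ 2) (by exact h.continuous_w.pow 2) 0 (2 * π)
  have c2 := continuous_parametric_intervalIntegral_of_continuous' (μ := volume)
    (f := fun t x => v t x ^ 2) (by exact h.continuous_v.pow 2) 0 (2 * π)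
  have c3 := continuous_parametric_intervalIntegral_of_continuous' (μ := volume)
    (f := fun t x => spacePrimitive w t x * v t x) (hG.mul h.continuous_v) 0 (2 * π)
  have c4 := continuous_parametric_intervalIntegral_of_continuous' (μ := volume) hG 0 (2 * π)
  have c5 := continuous_parametric_intervalIntegral_of_continuous' (μ := volume)
    h.continuous_v 0 (2 * π)
  exact ((c1.const_mul _).add (c2.const_mul _)).sub
    ((c3.sub ((c4.const_mul _).mul c5)).const_mul _)

theorem hasDerivAt_integral_sq (h : IsCenteredGoldsteinTaylor σ w v wx vx) {t : ℝ} (ht : 0 < t) :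
    HasDerivAt (fun s => (∫ x in (0 : ℝ)..(2 * π), w s x ^ 2) +
        ∫ x in (0 : ℝ)..(2 * π), v s x ^ 2)
      (-2 * σ * ∫ x in (0 : ℝ)..(2 * π), v t x ^ 2) t := by
  have hw (t) : Continuous (w t) := h.continuous_w.comp (Continuous.prodMk_right t)
  have hv (t) : Continuous (v t) := h.continuous_v.comp (Continuous.prodMk_right t)
  have hwx : Continuous (wx t) := continuousOn_univ.1 <|
    h.continuousOn_wx.comp (Continuous.prodMk_right t).continuousOn fun x _ => ⟨ht, mem_univ _⟩
  have hvx : Continuous (vx t) := continuousOn_univ.1 <|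
    h.continuousOn_vx.comp (Continuous.prodMk_right t).continuousOn fun x _ => ⟨ht, mem_univ _⟩
  have d1 := hasDerivAt_intervalIntegral_of_continuousOn 0 (2 * π) (f := fun t x => w t x ^ 2)
    (f' := fun t x => 2 * w t x * (-vx t x)) (fun t => (hw t).pow 2)
    ((h.continuous_w.const_mul 2).continuousOn.mul h.continuousOn_vx.neg)
    (fun t ht x => by simpa using (h.hasDerivAt_w_time t ht x).fun_pow 2) ht
  have d2 := hasDerivAt_intervalIntegral_of_continuousOn 0 (2 * π) (f := fun t x => v t x ^ 2)
    (f' := fun t x => 2 * v t x * (-wx t x - σ * v t x)) (fun t => (hv t).pow 2)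
    ((h.continuous_v.const_mul 2).continuousOn.mul
      (h.continuousOn_wx.neg.sub (h.continuous_v.const_mul σ).continuousOn))
    (fun t ht x => by simpa using (h.hasDerivAt_v_time t ht x).fun_pow 2) ht
  have hflux : ∫ x in (0 : ℝ)..(2 * π), (wx t x * v t x + w t x * vx t x) = 0 := by
    rw [integral_eq_sub_of_hasDerivAt
      (fun x _ => (h.hasDerivAt_w_space t ht x).fun_mul (h.hasDerivAt_v_space t ht x))
      (Continuous.intervalIntegrable (by fun_prop) _ _)]
    simp [h.periodic_v, h.periodic_w]
  refine (d1.fun_add d2).congr_deriv ?_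
  calc (∫ x in (0 : ℝ)..(2 * π), 2 * w t x * -vx t x) +
          ∫ x in (0 : ℝ)..(2 * π), 2 * v t x * (-wx t x - σ * v t x)
      = -2 * σ * (∫ x in (0 : ℝ)..(2 * π), v t x ^ 2) -
        2 * ∫ x in (0 : ℝ)..(2 * π), (wx t x * v t x + w t x * vx t x) := by
        rw [← intervalIntegral.integral_add, ← intervalIntegral.integral_const_mul,
          ← intervalIntegral.integral_const_mul, ← intervalIntegral.integral_sub]
        · exact intervalIntegral.integral_congr fun x _ => by ring
        all_goals exact Continuous.intervalIntegrable (by fun_prop) _ _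
    _ = _ := by rw [hflux, mul_zero, sub_zero]

theorem hasDerivAt_integral_antider_mul (h : IsCenteredGoldsteinTaylor σ w v wx vx) {t : ℝ}
    (ht : 0 < t) :
    HasDerivAt (fun s => ∫ x in (0 : ℝ)..(2 * π), antider (w s) x * v s x)
      ((∫ x in (0 : ℝ)..(2 * π), w t x ^ 2) - (∫ x in (0 : ℝ)..(2 * π), v t x ^ 2) -
        σ * (∫ x in (0 : ℝ)..(2 * π), antider (w t) x * v t x) +
        1 / (2 * π) * (∫ x in (0 : ℝ)..(2 * π), v t x) ^ 2) t := by
  have hw (t) : Continuous (w t) := h.continuous_w.comp (Continuous.prodMk_right t)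
  have hv (t) : Continuous (v t) := h.continuous_v.comp (Continuous.prodMk_right t)
  have hG := continuous_spacePrimitive h.continuous_w
  have hGt (t) : Continuous (spacePrimitive w t) := hG.comp (Continuous.prodMk_right t)
  have hwx : Continuous (wx t) := continuousOn_univ.1 <|
    h.continuousOn_wx.comp (Continuous.prodMk_right t).continuousOn fun x _ => ⟨ht, mem_univ _⟩
  have hvx (t) (ht : 0 < t) : Continuous (vx t) := continuousOn_univ.1 <|
    h.continuousOn_vx.comp (Continuous.prodMk_right t).continuousOn fun x _ => ⟨ht, mem_univ _⟩
  have hv0 : Continuous (fun p : ℝ × ℝ => v p.1 0) :=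
    h.continuous_v.comp (by fun_prop : Continuous fun p : ℝ × ℝ => (p.1, (0 : ℝ)))
  have hGx (x) : HasDerivAt (spacePrimitive w t) (w t x) x :=
    integral_hasDerivAt_right ((hw t).intervalIntegrable _ _)
      ((hw t).stronglyMeasurableAtFilter _ _) (hw t).continuousAt
  have hG_time (t) (ht : 0 < t) (x) :
      HasDerivAt (fun s => spacePrimitive w s x) (-(v t x - v t 0)) t := by
    refine (hasDerivAt_intervalIntegral_of_continuousOn 0 x hw
      (f' := fun t x => -vx t x) h.continuousOn_vx.neg h.hasDerivAt_w_time ht).congr_deriv ?_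
    rw [intervalIntegral.integral_neg, integral_eq_sub_of_hasDerivAt
      (fun x _ => h.hasDerivAt_v_space t ht x) ((hvx t ht).intervalIntegrable _ _)]
  have d1 := hasDerivAt_intervalIntegral_of_continuousOn 0 (2 * π)
    (f := fun t x => spacePrimitive w t x * v t x)
    (f' := fun t x => -(v t x - v t 0) * v t x +
      spacePrimitive w t x * (-wx t x - σ * v t x)) (fun t => (hGt t).mul (hv t))
    (((h.continuous_v.sub hv0).neg.mul h.continuous_v).continuousOn.add
      (hG.continuousOn.mul
        (h.continuousOn_wx.neg.sub (h.continuous_v.const_mul σ).continuousOn)))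
    (fun t ht x => (hG_time t ht x).fun_mul (h.hasDerivAt_v_time t ht x)) ht
  have d2 := hasDerivAt_intervalIntegral_of_continuousOn 0 (2 * π)
    (f := spacePrimitive w) (f' := fun t x => -(v t x - v t 0)) hGt
    (h.continuous_v.sub hv0).neg.continuousOn hG_time ht
  have d3 := hasDerivAt_intervalIntegral_of_continuousOn 0 (2 * π)
    (f := v) (f' := fun t x => -wx t x - σ * v t x) hv
    (h.continuousOn_wx.neg.sub (h.continuous_v.const_mul σ).continuousOn)
    h.hasDerivAt_v_time ht
  have e1 : ∫ x in (0 : ℝ)..(2 * π), (-(v t x - v t 0) * v t x +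
      spacePrimitive w t x * (-wx t x - σ * v t x)) =
      -(∫ x in (0 : ℝ)..(2 * π), v t x ^ 2) + v t 0 * (∫ x in (0 : ℝ)..(2 * π), v t x) +
      (∫ x in (0 : ℝ)..(2 * π), w t x ^ 2) -
      σ * ∫ x in (0 : ℝ)..(2 * π), spacePrimitive w t x * v t x := by
    have hparts : ∫ x in (0 : ℝ)..(2 * π), (w t x * w t x + spacePrimitive w t x * wx t x) = 0 := by
      rw [integral_eq_sub_of_hasDerivAt
        (fun x _ => (hGx x).fun_mul (h.hasDerivAt_w_space t ht x))
        (Continuous.intervalIntegrable (by fun_prop) _ _)]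
      simp [spacePrimitive, h.integral_w_eq_zero ht.le]
    calc _ = -(∫ x in (0 : ℝ)..(2 * π), v t x ^ 2) +
          v t 0 * (∫ x in (0 : ℝ)..(2 * π), v t x) + (∫ x in (0 : ℝ)..(2 * π), w t x ^ 2) -
          σ * (∫ x in (0 : ℝ)..(2 * π), spacePrimitive w t x * v t x) -
          ∫ x in (0 : ℝ)..(2 * π), (w t x * w t x + spacePrimitive w t x * wx t x) := by
          rw [← intervalIntegral.integral_neg, ← intervalIntegral.integral_const_mul,
            ← intervalIntegral.integral_const_mul, ← intervalIntegral.integral_add,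
            ← intervalIntegral.integral_add, ← intervalIntegral.integral_sub,
            ← intervalIntegral.integral_sub]
          · exact intervalIntegral.integral_congr fun x _ => by ring
          all_goals exact Continuous.intervalIntegrable (by fun_prop) _ _
      _ = _ := by rw [hparts, sub_zero]
  have e2 : ∫ x in (0 : ℝ)..(2 * π), -(v t x - v t 0) =
      2 * π * v t 0 - ∫ x in (0 : ℝ)..(2 * π), v t x := by
    rw [intervalIntegral.integral_neg,
      intervalIntegral.integral_sub ((hv t).intervalIntegrable _ _) (by simp)]
    simp
  have e3 : ∫ x in (0 : ℝ)..(2 * π), (-wx t x - σ * v t x) =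
      -σ * ∫ x in (0 : ℝ)..(2 * π), v t x := by
    rw [intervalIntegral.integral_sub, intervalIntegral.integral_neg,
      integral_eq_sub_of_hasDerivAt (fun x _ => h.hasDerivAt_w_space t ht x)
      (hwx.intervalIntegrable _ _), h.periodic_w, intervalIntegral.integral_const_mul]
    · ring
    all_goals exact Continuous.intervalIntegrable (by fun_prop) _ _
  rw [e1] at d1
  rw [e2] at d2
  rw [e3] at d3
  simp only [integral_antider_mul (hw _) (hv _)]
  refine (d1.fun_sub ((d2.const_mul (1 / (2 * π))).fun_mul d3)).congr_deriv ?_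
  simp only [← spacePrimitive.eq_1 w]
  field_simp
  ring

end IsCenteredGoldsteinTaylor

theorem continuous_uncurry_max {f : ℝ → ℝ → ℝ}
    (hf : ContDiffOn ℝ 1 (Function.uncurry f) (Ici (0 : ℝ) ×ˢ univ)) :
    Continuous (Function.uncurry fun t x => f (max t 0) x) :=
  hf.continuousOn.comp_continuous (f := fun p : ℝ × ℝ => (max p.1 0, p.2)) (by fun_prop)
    fun p => ⟨le_max_right p.1 0, mem_univ _⟩

theorem hasFDerivAt_uncurry_of_pos {f : ℝ → ℝ → ℝ}
    (hf : ContDiffOn ℝ 1 (Function.uncurry f) (Ici (0 : ℝ) ×ˢ univ)) {t : ℝ} (ht : 0 < t) (x : ℝ) :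
    HasFDerivAt (Function.uncurry f) (fderiv ℝ (Function.uncurry f) (t, x)) (t, x) :=
  ((hf.contDiffAt (prod_mem_nhds (Ici_mem_nhds ht) Filter.univ_mem)).differentiableAt
    one_ne_zero).hasFDerivAt

theorem hasDerivAt_space {f : ℝ → ℝ → ℝ}
    (hf : ContDiffOn ℝ 1 (Function.uncurry f) (Ici (0 : ℝ) ×ˢ univ)) {t : ℝ} (ht : 0 < t) (x : ℝ) :
    HasDerivAt (f t) (fderiv ℝ (Function.uncurry f) (t, x) (0, 1)) x :=
  (hasFDerivAt_uncurry_of_pos hf ht x).comp_hasDerivAt x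
    ((hasDerivAt_const x t).prodMk (hasDerivAt_id x))

theorem hasDerivAt_time {f : ℝ → ℝ → ℝ}
    (hf : ContDiffOn ℝ 1 (Function.uncurry f) (Ici (0 : ℝ) ×ˢ univ)) {t : ℝ} (ht : 0 < t) (x : ℝ) :
    HasDerivAt (fun s => f s x) (deriv (fun s => f s x) t) t :=
  have h : DifferentiableAt ℝ (fun s => f s x) t :=
    (hasFDerivAt_uncurry_of_pos hf ht x).differentiableAt.comp (f := fun s => (s, x)) t
      (by fun_prop)
  h.hasDerivAt

theorem continuousOn_deriv_space {f : ℝ → ℝ → ℝ}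
    (hf : ContDiffOn ℝ 1 (Function.uncurry f) (Ici (0 : ℝ) ×ˢ univ)) :
    ContinuousOn (Function.uncurry fun t x => deriv (f t) x) (Ioi (0 : ℝ) ×ˢ univ) := by
  have h := (hf.mono (prod_mono_left Ioi_subset_Ici_self)).continuousOn_fderiv_of_isOpen
    (isOpen_Ioi.prod isOpen_univ) le_rfl
  exact (h.clm_apply continuousOn_const).congr fun p hp => (hasDerivAt_space hf hp.1 p.2).deriv

theorem IsCenteredGoldsteinTaylor.entropyE_le {σ : ℝ} {w v wx vx : ℝ → ℝ → ℝ}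
    (h : IsCenteredGoldsteinTaylor σ w v wx vx) (hσ : 0 < σ) {t : ℝ} (ht : 0 ≤ t) :
    entropyE (if σ < 2 then σ else 4 / σ) (w t) (v t) ≤
      entropyE (if σ < 2 then σ else 4 / σ) (w 0) (v 0) *
        exp (-(2 * (if σ < 2 then σ / 2 else σ / 2 - √(σ ^ 2 / 4 - 1))) * t) := by
  set θ := if σ < 2 then σ else 4 / σ with hθ
  refine le_mul_exp_of_deriv_le (y := fun t => entropyE θ (w t) (v t))
    (h.entropyE_continuous θ).continuousOn (fun t ht => ?_) (fun t ht => ?_) ht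
    (y' := fun t => 1 / (2 * π) * (-2 * σ * (∫ x in (0 : ℝ)..(2 * π), v t x ^ 2) -
      θ * ((∫ x in (0 : ℝ)..(2 * π), w t x ^ 2) - (∫ x in (0 : ℝ)..(2 * π), v t x ^ 2) -
        σ * (∫ x in (0 : ℝ)..(2 * π), antider (w t) x * v t x) +
        1 / (2 * π) * (∫ x in (0 : ℝ)..(2 * π), v t x) ^ 2)))
  · refine (((h.hasDerivAt_integral_sq ht).fun_sub
      ((h.hasDerivAt_integral_antider_mul ht).const_mul θ)).const_mul
        (1 / (2 * π))).congr_of_eventuallyEq (.of_forall fun s => ?_)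
    simp only [entropyE, nsq]
    ring
  · have hquad := entropy_quadratic_nonneg (h.continuous_w.comp (Continuous.prodMk_right t))
      (h.continuous_v.comp (Continuous.prodMk_right t)) (h.integral_w_eq_zero ht.le)
    simp only [Function.comp_apply, Function.uncurry_apply_pair] at hquad
    have hE : entropyE θ (w t) (v t) = 1 / (2 * π) * ((∫ x in (0 : ℝ)..(2 * π), w t x ^ 2) +
        (∫ x in (0 : ℝ)..(2 * π), v t x ^ 2) -
        θ * ∫ x in (0 : ℝ)..(2 * π), antider (w t) x * v t x) := by
      simp only [entropyE, nsq]
      ring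
    rw [hE, mul_left_comm]
    refine mul_le_mul_of_nonneg_left ?_ (by positivity)
    have hm : 0 ≤ 1 / (2 * π) * (∫ x in (0 : ℝ)..(2 * π), v t x) ^ 2 := by positivity
    change ∀ r : ℝ, 0 ≤ _ - 2 * r * (∫ x in (0 : ℝ)..(2 * π), antider (w t) x * v t x) + _ at hquad
    generalize (∫ x in (0 : ℝ)..(2 * π), w t x ^ 2) = P at *
    generalize (∫ x in (0 : ℝ)..(2 * π), v t x ^ 2) = Q at *
    generalize (∫ x in (0 : ℝ)..(2 * π), antider (w t) x * v t x) = C at *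
    generalize 1 / (2 * π) * (∫ x in (0 : ℝ)..(2 * π), v t x) ^ 2 = m at *
    split_ifs at hθ ⊢ with h2
    · rw [hθ]
      nlinarith [mul_nonneg hσ.le hm]
    · obtain ⟨a, rfl⟩ : ∃ a, σ = 2 * a := ⟨σ / 2, by ring⟩
      have ha : 1 ≤ a := by linarith
      have hrad : (2 * a) ^ 2 / 4 - 1 = a ^ 2 - 1 := by ring
      rw [hrad, show 2 * a / 2 = a by ring]
      have hs2 := sq_sqrt (show 0 ≤ a ^ 2 - 1 by nlinarith)
      have hs0 := sqrt_nonneg (a ^ 2 - 1)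
      generalize √(a ^ 2 - 1) = s at *
      have hsa : 0 ≤ a - s := by nlinarith
      have hq : 0 ≤ (a - s) * P - 2 * C + (a + s) * Q := by
        have := mul_nonneg hsa (hquad (a + s))
        have e : (a - s) * (P - 2 * (a + s) * C + (a + s) ^ 2 * Q) =
            (a - s) * P - 2 * (a ^ 2 - s ^ 2) * C + (a ^ 2 - s ^ 2) * (a + s) * Q := by ring
        rw [e, hs2] at this
        linarith
      have key : -2 * (2 * a) * Q - θ * (P - Q - 2 * a * C + m) +
          2 * (a - s) * (P + Q - θ * C) =
          -(2 * s / a * ((a - s) * P - 2 * C + (a + s) * Q) + θ * m) := by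
        rw [hθ]
        field_simp
        linear_combination (-4 * P + 4 * Q) * hs2
      have : 0 ≤ 2 * s / a * ((a - s) * P - 2 * C + (a + s) * Q) + θ * m :=
        add_nonneg (mul_nonneg (by positivity) hq) (mul_nonneg (by rw [hθ]; positivity) hm)
      linarith

/-- Theorem 1.1 (a), entropy decay for constant σ ≠ 2 (paper: Goldstein–Taylor, arXiv:2007.11792). -/
theorem gt_constant_entropy_decay
    (σ : ℝ) (hσ0 : 0 < σ) (hσ2 : σ ≠ 2)
    (u v : ℝ → ℝ → ℝ) (u₀ v₀ : ℝ → ℝ)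
    (huC : ContDiffOn ℝ 1 (Function.uncurry u) (Set.Ici (0:ℝ) ×ˢ Set.univ))
    (hvC : ContDiffOn ℝ 1 (Function.uncurry v) (Set.Ici (0:ℝ) ×ˢ Set.univ))
    (hup : ∀ t, Function.Periodic (u t) (2 * π))
    (hvp : ∀ t, Function.Periodic (v t) (2 * π))
    (hpde1 : ∀ t, 0 < t → ∀ x, deriv (fun s => u s x) t + deriv (fun y => v t y) x = 0)
    (hpde2 : ∀ t, 0 < t → ∀ x,
      deriv (fun s => v s x) t + deriv (fun y => u t y) x = -σ * v t x)
    (hu0 : ∀ x, u 0 x = u₀ x) (hv0 : ∀ x, v 0 x = v₀ x) :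
    ∀ t, 0 ≤ t →
      entropyE (if σ < 2 then σ else 4 / σ) (fun x => u t x - havg u₀) (v t) ≤
        entropyE (if σ < 2 then σ else 4 / σ) (fun x => u₀ x - havg u₀) v₀ *
          Real.exp (-(2 * (if σ < 2 then σ / 2 else σ / 2 - Real.sqrt (σ ^ 2 / 4 - 1))) * t) := by
  intro t ht
  obtain rfl : u 0 = u₀ := funext hu0
  obtain rfl : v 0 = v₀ := funext hv0
  have hdu (t : ℝ) (ht : 0 < t) (x : ℝ) : HasDerivAt (u t) (deriv (u t) x) x :=
    (hasDerivAt_space huC ht x).differentiableAt.hasDerivAt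
  have hdv (t : ℝ) (ht : 0 < t) (x : ℝ) : HasDerivAt (v t) (deriv (v t) x) x :=
    (hasDerivAt_space hvC ht x).differentiableAt.hasDerivAt
  have hmax (t : ℝ) (ht : 0 < t) : (fun s => max s 0) =ᶠ[nhds t] id :=
    (lt_mem_nhds ht).mono fun s hs => max_eq_left hs.le
  have hsol : IsCenteredGoldsteinTaylor σ (fun t x => u (max t 0) x - havg (u 0))
      (fun t => v (max t 0)) (fun t x => deriv (u t) x) (fun t x => deriv (v t) x) := by
    refine ⟨(continuous_uncurry_max huC).sub continuous_const, continuous_uncurry_max hvC,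
      continuousOn_deriv_space huC, continuousOn_deriv_space hvC, fun t ht x => ?_,
      fun t ht x => ?_, fun t ht x => ?_, fun t ht x => ?_, fun t => ?_, fun t => ?_, ?_⟩
    · simpa only [max_eq_left ht.le] using (hdu t ht x).sub_const _
    · simpa only [max_eq_left ht.le] using hdv t ht x
    · have h := hasDerivAt_time huC ht x
      rw [eq_neg_of_add_eq_zero_left (hpde1 t ht x)] at h
      exact (h.congr_of_eventuallyEq ((hmax t ht).fun_comp (u · x))).sub_const _
    · have h := hasDerivAt_time hvC ht x
      rw [eq_sub_of_add_eq (hpde2 t ht x)] at h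
      refine (h.congr_of_eventuallyEq ((hmax t ht).fun_comp (v · x))).congr_deriv ?_
      simp only [max_eq_left ht.le]
      ring
    · simpa using hup (max t 0) 0
    · simpa using hvp (max t 0) 0
    · have hu : Continuous (u 0) := by
        simpa [Function.comp_def] using
          (continuous_uncurry_max huC).comp (Continuous.prodMk_right (0 : ℝ))
      simp only [max_self]
      rw [intervalIntegral.integral_sub (hu.intervalIntegrable _ _) (by simp),
        intervalIntegral.integral_const, havg, smul_eq_mul]
      field_simp
      ring
  simpa only [max_eq_left ht, max_self] using hsol.entropyE_le hσ0 ht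
end

section
/- Let σ = 2 (constant), and let u, v be a real-valued classical solution of the Goldstein–Taylor system ∂ₜu + ∂ₓv = 0, ∂ₜv + ∂ₓu = −2v on 𝕋 × (0,∞) with initial data u₀, v₀. Set f₊ := (u+v)/2, f₋ := (u−v)/2 and f∞ := (u₀)_avg/2. Then for every 0 < ε < 1 and all t ≥ 0: √(‖f₊(·,t) − f∞‖² + ‖f₋(·,t) − f∞‖²) ≤ (√2/ε) · √(‖f₊(·,0) − f∞‖² + ‖f₋(·,0) − f∞‖²) · e^{−(1−ε)t}. -/
open MeasureTheory Real

/-- Wirtinger's inequality on `[0, 2π]`. -/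
theorem wirtinger_inequality {f f' : ℝ → ℝ} (hf : ∀ x, HasDerivAt f (f' x) x)
    (hf' : Continuous f') (hper : f (2 * π) = f 0)
    (hmean : ∫ x in (0:ℝ)..(2 * π), f x = 0) :
    ∫ x in (0:ℝ)..(2 * π), f x ^ 2 ≤ ∫ x in (0:ℝ)..(2 * π), f' x ^ 2 := by
  have hab : (0:ℝ) < 2 * π := by positivity
  have hfc : Continuous f := continuous_iff_continuousAt.2 fun x => (hf x).continuousAt
  have parseval : ∀ g : ℝ → ℝ, Continuous g →
      HasSum (fun i => ‖fourierCoeffOn hab (fun x => (g x : ℂ)) i‖ ^ 2)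
        ((2 * π)⁻¹ * ∫ x in (0:ℝ)..(2 * π), g x ^ 2) := by
    intro g hg
    have hgc : Continuous fun x => (g x : ℂ) := Complex.continuous_ofReal.comp hg
    obtain ⟨C, hC⟩ := (isCompact_Icc (a := (0:ℝ)) (b := 2 * π)).exists_bound_of_continuousOn
      hgc.continuousOn
    have hmem : MemLp (fun x => (g x : ℂ)) 2 (volume.restrict (Set.Ioc 0 (2 * π))) :=
      MemLp.of_bound hgc.aestronglyMeasurable C
        ((ae_restrict_mem measurableSet_Ioc).mono fun x hx => hC x (Set.Ioc_subset_Icc_self hx))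
    simpa using hasSum_sq_fourierCoeffOn hab hmem
  have hle : ∀ i : ℤ, ‖fourierCoeffOn hab (fun x => (f x : ℂ)) i‖ ^ 2 ≤
      ‖fourierCoeffOn hab (fun x => (f' x : ℂ)) i‖ ^ 2 := by
    intro i
    gcongr
    rcases eq_or_ne i 0 with rfl | hi
    · rw [fourierCoeffOn_eq_integral]
      have : ∫ x in (0:ℝ)..(2 * π), (f x : ℂ) = 0 := by
        rw [intervalIntegral.integral_ofReal, hmean, Complex.ofReal_zero]
      simp [this]
    · have h := fourierCoeffOn_of_hasDerivAt hab hi (f := fun x => (f x : ℂ))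
        (f' := fun x => (f' x : ℂ)) (fun x _ => (hf x).ofReal_comp)
        ((Complex.continuous_ofReal.comp hf').intervalIntegrable _ _)
      rw [h, hper, sub_self, mul_zero, zero_sub, norm_mul, norm_neg, norm_mul]
      have hi1 : (1:ℝ) ≤ |(i:ℝ)| := by exact_mod_cast Int.one_le_abs hi
      have e : ‖(1:ℂ) / (-2 * π * Complex.I * i)‖ * ‖((2 * π : ℝ) : ℂ) - ((0:ℝ) : ℂ)‖ =
          1 / |(i:ℝ)| := by
        simp [abs_of_pos Real.pi_pos]
        field_simp
      rw [← mul_assoc, e]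
      exact mul_le_of_le_one_left (norm_nonneg _) (by
        rw [div_le_one (by linarith)]; exact hi1)
  have h := hasSum_le hle (parseval f hfc) (parseval f' hf')
  exact le_of_mul_le_mul_left h (by positivity)

/-- Differentiation under the integral sign for integrands that are `C¹` in the parameter. -/
theorem hasDerivAt_intervalIntegral_of_continuousOn_s3 {F F' : ℝ → ℝ → ℝ} (a b : ℝ)
    (hF : ∀ t, 0 < t → Continuous (F t))
    (hd : ∀ t, 0 < t → ∀ x, HasDerivAt (fun s => F s x) (F' t x) t)
    (hF' : ContinuousOn (Function.uncurry F') (Set.Ioi 0 ×ˢ Set.univ)) {t : ℝ} (ht : 0 < t) :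
    HasDerivAt (fun s => ∫ x in a..b, F s x) (∫ x in a..b, F' t x) t := by
  have hK : IsCompact (Set.Icc (t / 2) (2 * t) ×ˢ Set.uIcc a b) :=
    isCompact_Icc.prod isCompact_uIcc
  have hsub : Set.Icc (t / 2) (2 * t) ×ˢ Set.uIcc a b ⊆ Set.Ioi (0:ℝ) ×ˢ Set.univ := by
    rintro ⟨s, x⟩ ⟨hs, -⟩
    exact ⟨by have := hs.1; simp only [Set.mem_Ioi] at *; linarith, trivial⟩
  obtain ⟨C, hC⟩ := hK.exists_bound_of_continuousOn (hF'.mono hsub)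
  have hF't : Continuous (F' t) := by
    rw [← continuousOn_univ]
    exact hF'.comp (f := fun x => (t, x)) (by fun_prop) (fun x _ => ⟨ht, trivial⟩)
  refine (intervalIntegral.hasDerivAt_integral_of_dominated_loc_of_deriv_le
    (s := Set.Icc (t / 2) (2 * t)) (bound := fun _ => C)
    (Icc_mem_nhds (by linarith) (by linarith)) ?_ ((hF t ht).intervalIntegrable _ _)
    hF't.aestronglyMeasurable ?_ (by simp) ?_).2
  · filter_upwards [Ioi_mem_nhds ht] with s hs using (hF s hs).aestronglyMeasurable
  · exact Filter.Eventually.of_forall fun x hx s hs => hC (s, x) ⟨hs, Set.uIoc_subset_uIcc hx⟩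
  · exact Filter.Eventually.of_forall fun x _ s hs => hd s (by linarith [hs.1]) x

/-- Young's inequality for the pairing of the mean-free antiderivative of `w` with `v`, where
Wirtinger's inequality bounds the antiderivative by `w` itself. -/
theorem young_wirtinger {w v : ℝ → ℝ} (hw : Continuous w) (hv : Continuous v)
    (hmean : ∫ x in (0:ℝ)..(2 * π), w x = 0) (α β : ℝ) :
    0 ≤ α ^ 2 * (∫ x in (0:ℝ)..(2 * π), w x ^ 2) -
      2 * α * β * ((∫ x in (0:ℝ)..(2 * π), (∫ y in (0:ℝ)..x, w y) * v x) -
        (∫ x in (0:ℝ)..(2 * π), ∫ y in (0:ℝ)..x, w y) * (∫ x in (0:ℝ)..(2 * π), v x) / (2 * π)) +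
      β ^ 2 * ∫ x in (0:ℝ)..(2 * π), v x ^ 2 := by
  set Φ : ℝ → ℝ := fun x => ∫ y in (0:ℝ)..x, w y with hΦ
  have hΦd : ∀ x, HasDerivAt Φ (w x) x := fun x =>
    intervalIntegral.integral_hasDerivAt_right (hw.intervalIntegrable _ _)
      hw.aestronglyMeasurable.stronglyMeasurableAtFilter hw.continuousAt
  have hΦc : Continuous Φ := continuous_iff_continuousAt.2 fun x => (hΦd x).continuousAt
  set c : ℝ := (∫ x in (0:ℝ)..(2 * π), Φ x) / (2 * π) with hc
  have hwirt := wirtinger_inequality (f := fun x => Φ x - c) (fun x => (hΦd x).sub_const c) hw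
    (by simp [hΦ, hmean])
    (by
      rw [intervalIntegral.integral_sub (hΦc.intervalIntegrable _ _) (by simp)]
      simp only [intervalIntegral.integral_const, hc, smul_eq_mul]
      field_simp
      ring)
  have hsq : 0 ≤ ∫ x in (0:ℝ)..(2 * π), (α * (Φ x - c) - β * v x) ^ 2 :=
    intervalIntegral.integral_nonneg (by positivity) fun x _ => sq_nonneg _
  have hexp : ∫ x in (0:ℝ)..(2 * π), (α * (Φ x - c) - β * v x) ^ 2 =
      α ^ 2 * (∫ x in (0:ℝ)..(2 * π), (Φ x - c) ^ 2) -
        2 * α * β * ((∫ x in (0:ℝ)..(2 * π), Φ x * v x) - c * ∫ x in (0:ℝ)..(2 * π), v x) +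
        β ^ 2 * ∫ x in (0:ℝ)..(2 * π), v x ^ 2 := by
    simp only [← intervalIntegral.integral_const_mul]
    rw [← intervalIntegral.integral_sub (Continuous.intervalIntegrable (by fun_prop) _ _)
        (Continuous.intervalIntegrable (by fun_prop) _ _),
      ← intervalIntegral.integral_const_mul,
      ← intervalIntegral.integral_sub (Continuous.intervalIntegrable (by fun_prop) _ _)
        (Continuous.intervalIntegrable (by fun_prop) _ _),
      ← intervalIntegral.integral_add (Continuous.intervalIntegrable (by fun_prop) _ _)
        (Continuous.intervalIntegrable (by fun_prop) _ _)]
    exact intervalIntegral.integral_congr fun x _ => by ring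
  rw [hexp] at hsq
  have hcv : (∫ x in (0:ℝ)..(2 * π), Φ x) * (∫ x in (0:ℝ)..(2 * π), v x) / (2 * π) =
      c * ∫ x in (0:ℝ)..(2 * π), v x := by rw [hc]; ring
  rw [hcv]
  linarith [mul_le_mul_of_nonneg_left hwirt (sq_nonneg α)]

/-- Exponential decay of the `L²` norm for the Goldstein–Taylor system with relaxation rate `2`,
with the partial derivatives `a = ∂ₓw` and `b = ∂ₓv` given explicitly. -/
theorem goldsteinTaylor_energy_decay {w v a b : ℝ → ℝ → ℝ}
    (hw : Continuous (Function.uncurry w)) (hv : Continuous (Function.uncurry v))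
    (ha : ContinuousOn (Function.uncurry a) (Set.Ioi 0 ×ˢ Set.univ))
    (hb : ContinuousOn (Function.uncurry b) (Set.Ioi 0 ×ˢ Set.univ))
    (hwx : ∀ t, 0 < t → ∀ x, HasDerivAt (w t) (a t x) x)
    (hvx : ∀ t, 0 < t → ∀ x, HasDerivAt (v t) (b t x) x)
    (hwt : ∀ t, 0 < t → ∀ x, HasDerivAt (fun s => w s x) (-b t x) t)
    (hvt : ∀ t, 0 < t → ∀ x, HasDerivAt (fun s => v s x) (-a t x - 2 * v t x) t)
    (hwp : ∀ t, w t (2 * π) = w t 0) (hvp : ∀ t, v t (2 * π) = v t 0)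
    (hmean : ∫ x in (0:ℝ)..(2 * π), w 0 x = 0)
    {ε : ℝ} (hε0 : 0 < ε) (hε1 : ε < 1) {t : ℝ} (ht : 0 ≤ t) :
    ε ^ 2 * ((∫ x in (0:ℝ)..(2 * π), w t x ^ 2) + ∫ x in (0:ℝ)..(2 * π), v t x ^ 2) ≤
      ((∫ x in (0:ℝ)..(2 * π), w 0 x ^ 2) + ∫ x in (0:ℝ)..(2 * π), v 0 x ^ 2) *
        Real.exp (-(2 * (1 - ε) * t)) := by
  have hwtc : ∀ t, Continuous (w t) := fun t => hw.comp (Continuous.prodMk_right t)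
  have hvtc : ∀ t, Continuous (v t) := fun t => hv.comp (Continuous.prodMk_right t)
  have hac : ∀ t, 0 < t → Continuous (a t) := fun t ht => by
    rw [← continuousOn_univ]
    exact ha.comp (f := fun x => (t, x)) (by fun_prop) (fun x _ => ⟨ht, trivial⟩)
  have hbc : ∀ t, 0 < t → Continuous (b t) := fun t ht => by
    rw [← continuousOn_univ]
    exact hb.comp (f := fun x => (t, x)) (by fun_prop) (fun x _ => ⟨ht, trivial⟩)
  set Φ : ℝ → ℝ → ℝ := fun t x => ∫ y in (0:ℝ)..x, w t y with hΦ
  have hΦc : Continuous (Function.uncurry Φ) :=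
    intervalIntegral.continuous_parametric_primitive_of_continuous hw
  have hΦtc : ∀ t, Continuous (Φ t) := fun t => hΦc.comp (Continuous.prodMk_right t)
  have hΦx : ∀ t x, HasDerivAt (Φ t) (w t x) x := fun t x =>
    intervalIntegral.integral_hasDerivAt_right ((hwtc t).intervalIntegrable _ _)
      (hwtc t).aestronglyMeasurable.stronglyMeasurableAtFilter (hwtc t).continuousAt
  have hΦt : ∀ t, 0 < t → ∀ x, HasDerivAt (fun s => Φ s x) (v t 0 - v t x) t := by
    intro t ht x
    have h := hasDerivAt_intervalIntegral_of_continuousOn_s3 0 x (fun t _ => hwtc t) hwt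
      (F' := fun t x => -b t x) hb.neg ht
    have e : ∫ y in (0:ℝ)..x, -b t y = v t 0 - v t x := by
      rw [intervalIntegral.integral_neg, intervalIntegral.integral_eq_sub_of_hasDerivAt
        (fun y _ => hvx t ht y) ((hbc t ht).intervalIntegrable _ _)]
      ring
    rwa [e] at h
  have hv0 : Continuous fun p : ℝ × ℝ => v p.1 0 := hv.comp (by fun_prop : Continuous
    fun p : ℝ × ℝ => (p.1, (0:ℝ)))
  set P : ℝ → ℝ := fun t => ∫ x in (0:ℝ)..(2 * π), w t x ^ 2 with hP
  set Q : ℝ → ℝ := fun t => ∫ x in (0:ℝ)..(2 * π), v t x ^ 2 with hQ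
  set S : ℝ → ℝ := fun t => ∫ x in (0:ℝ)..(2 * π), Φ t x * v t x with hS
  set C : ℝ → ℝ := fun t => ∫ x in (0:ℝ)..(2 * π), Φ t x with hC
  set V : ℝ → ℝ := fun t => ∫ x in (0:ℝ)..(2 * π), v t x with hV
  have hPc : Continuous P :=
    intervalIntegral.continuous_parametric_intervalIntegral_of_continuous' (hw.pow 2) _ _
  have hQc : Continuous Q :=
    intervalIntegral.continuous_parametric_intervalIntegral_of_continuous' (hv.pow 2) _ _
  have hSc : Continuous S :=
    intervalIntegral.continuous_parametric_intervalIntegral_of_continuous' (hΦc.mul hv) _ _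
  have hCc : Continuous C :=
    intervalIntegral.continuous_parametric_intervalIntegral_of_continuous' hΦc _ _
  have hVc : Continuous V :=
    intervalIntegral.continuous_parametric_intervalIntegral_of_continuous' hv _ _
  have hmass : ∀ t, 0 ≤ t → ∫ x in (0:ℝ)..(2 * π), w t x = 0 := by
    intro t ht
    have hcont : Continuous fun t => Φ t (2 * π) :=
      intervalIntegral.continuous_parametric_intervalIntegral_of_continuous' hw _ _
    have hder : ∀ s ∈ Set.Ioo 0 t, HasDerivAt (fun s => Φ s (2 * π)) 0 s := fun s hs => by
      simpa [hvp] using hΦt s hs.1 (2 * π)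
    have := intervalIntegral.integral_eq_sub_of_hasDerivAt_of_le ht hcont.continuousOn
      hder (by simp)
    simp only [intervalIntegral.integral_zero, hΦ, hmean] at this
    linarith
  have hPd : ∀ t, 0 < t → HasDerivAt P (∫ x in (0:ℝ)..(2 * π), -(2 * w t x * b t x)) t := by
    intro t ht
    refine hasDerivAt_intervalIntegral_of_continuousOn_s3 0 (2 * π) (F := fun t x => w t x ^ 2)
      (F' := fun t x => -(2 * w t x * b t x))
      (fun t _ => (hwtc t).pow 2) (fun t ht x => ?_)
      (((hw.continuousOn.const_mul 2).mul hb).neg) ht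
    exact ((hwt t ht x).pow 2).congr_deriv (by push_cast; ring)
  have hQd : ∀ t, 0 < t → HasDerivAt Q
      (∫ x in (0:ℝ)..(2 * π), (2 * v t x * (-a t x - 2 * v t x))) t := by
    intro t ht
    refine hasDerivAt_intervalIntegral_of_continuousOn_s3 0 (2 * π) (F := fun t x => v t x ^ 2)
      (F' := fun t x => 2 * v t x * (-a t x - 2 * v t x))
      (fun t _ => (hvtc t).pow 2) (fun t ht x => ?_)
      ((hv.continuousOn.const_mul 2).mul (ha.neg.sub (hv.continuousOn.const_mul 2))) ht
    exact ((hvt t ht x).pow 2).congr_deriv (by push_cast; ring)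
  have hPQd : ∀ t, 0 < t → HasDerivAt (fun t => P t + Q t) (-4 * Q t) t := by
    intro t ht
    refine HasDerivAt.congr_deriv ((hPd t ht).add (hQd t ht)) (Eq.symm ?_)
    have := hac t ht
    have := hbc t ht
    have := hwtc t
    have := hvtc t
    have hz := intervalIntegral.integral_eq_sub_of_hasDerivAt (a := 0) (b := 2 * π)
      (fun x _ => (hwx t ht x).mul (hvx t ht x))
      (Continuous.intervalIntegrable (by fun_prop) _ _)
    simp only [Pi.mul_apply, hwp, hvp, sub_self] at hz
    rw [← intervalIntegral.integral_add (Continuous.intervalIntegrable (by fun_prop) _ _)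
      (Continuous.intervalIntegrable (by fun_prop) _ _)]
    have e : -4 * Q t = -4 * Q t + -2 * ∫ x in (0:ℝ)..(2 * π), (a t x * v t x + w t x * b t x) := by
      rw [hz]; ring
    rw [e, hQ, ← intervalIntegral.integral_const_mul, ← intervalIntegral.integral_const_mul,
      ← intervalIntegral.integral_add (Continuous.intervalIntegrable (by fun_prop) _ _)
      (Continuous.intervalIntegrable (by fun_prop) _ _)]
    exact intervalIntegral.integral_congr fun x _ => by ring
  have hVd : ∀ t, 0 < t → HasDerivAt V (-2 * V t) t := by
    intro t ht
    refine HasDerivAt.congr_deriv (hasDerivAt_intervalIntegral_of_continuousOn_s3 0 (2 * π) (fun t _ => hvtc t) hvt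
      (F' := fun t x => -a t x - 2 * v t x) (ha.neg.sub (hv.continuousOn.const_mul 2)) ht) (Eq.symm ?_)
    have := hac t ht
    have := hvtc t
    have hz := intervalIntegral.integral_eq_sub_of_hasDerivAt (a := 0) (b := 2 * π)
      (fun x _ => hwx t ht x) ((hac t ht).intervalIntegrable _ _)
    rw [hwp, sub_self] at hz
    rw [intervalIntegral.integral_sub (Continuous.intervalIntegrable (by fun_prop) _ _)
      (Continuous.intervalIntegrable (by fun_prop) _ _), intervalIntegral.integral_neg, hz,
      intervalIntegral.integral_const_mul]
    ring
  have hCd : ∀ t, 0 < t → HasDerivAt C (2 * π * v t 0 - V t) t := by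
    intro t ht
    refine HasDerivAt.congr_deriv (hasDerivAt_intervalIntegral_of_continuousOn_s3 0 (2 * π) (fun t _ => hΦtc t) hΦt
      (F' := fun t x => v t 0 - v t x) (hv0.sub hv).continuousOn ht) (Eq.symm ?_)
    rw [intervalIntegral.integral_sub (by simp) ((hvtc t).intervalIntegrable _ _)]
    simp [hV]
  have hSd : ∀ t, 0 < t → HasDerivAt S (v t 0 * V t - Q t + P t - 2 * S t) t := by
    intro t ht
    refine HasDerivAt.congr_deriv (hasDerivAt_intervalIntegral_of_continuousOn_s3 0 (2 * π)
      (F := fun t x => Φ t x * v t x)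
      (F' := fun t x => (v t 0 - v t x) * v t x + Φ t x * (-a t x - 2 * v t x))
      (fun t _ => (hΦtc t).mul (hvtc t)) (fun t ht x => (hΦt t ht x).mul (hvt t ht x))
      (((hv0.sub hv).mul hv).continuousOn.add
        (hΦc.continuousOn.mul (ha.neg.sub (hv.continuousOn.const_mul 2)))) ht) (Eq.symm ?_)
    have := hac t ht
    have := hwtc t
    have := hvtc t
    have := hΦtc t
    have hz := intervalIntegral.integral_eq_sub_of_hasDerivAt (a := 0) (b := 2 * π)
      (fun x _ => (hΦx t x).mul (hwx t ht x))
      (Continuous.intervalIntegrable (by fun_prop) _ _)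
    have hΦ0 : Φ t 0 = 0 := by simp [hΦ]
    have hΦ1 : Φ t (2 * π) = 0 := hmass t ht.le
    simp only [Pi.mul_apply, hΦ0, hΦ1, zero_mul, sub_self] at hz
    have e : v t 0 * V t - Q t + P t - 2 * S t = v t 0 * V t - Q t + P t - 2 * S t -
        ∫ x in (0:ℝ)..(2 * π), (w t x * w t x + Φ t x * a t x) := by
      rw [hz]; ring
    rw [e, hV, hQ, hP, hS]
    simp only [← intervalIntegral.integral_const_mul]
    rw [← intervalIntegral.integral_sub (Continuous.intervalIntegrable (by fun_prop) _ _)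
        (Continuous.intervalIntegrable (by fun_prop) _ _),
      ← intervalIntegral.integral_add (Continuous.intervalIntegrable (by fun_prop) _ _)
        (Continuous.intervalIntegrable (by fun_prop) _ _),
      ← intervalIntegral.integral_sub (Continuous.intervalIntegrable (by fun_prop) _ _)
        (Continuous.intervalIntegrable (by fun_prop) _ _),
      ← intervalIntegral.integral_sub (Continuous.intervalIntegrable (by fun_prop) _ _)
        (Continuous.intervalIntegrable (by fun_prop) _ _)]
    exact intervalIntegral.integral_congr fun x _ => by ring
  set G : ℝ → ℝ := fun t => S t - C t * V t / (2 * π) with hG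
  have hGd : ∀ t, 0 < t → HasDerivAt G (P t - Q t - 2 * G t + V t ^ 2 / (2 * π)) t := by
    intro t ht
    refine HasDerivAt.congr_deriv ((hSd t ht).sub (((hCd t ht).mul (hVd t ht)).div_const (2 * π))) (Eq.symm ?_)
    simp only [hG]
    field_simp
    ring
  have hyoung : ∀ t, 0 ≤ t → ∀ α β : ℝ,
      0 ≤ α ^ 2 * P t - 2 * α * β * G t + β ^ 2 * Q t := fun t ht α β =>
    young_wirtinger (hwtc t) (hvtc t) (hmass t ht) α β
  set E : ℝ → ℝ := fun t => (1 + ε ^ 2) * (P t + Q t) - 2 * (1 - ε ^ 2) * G t with hE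
  have hEd : ∀ t, 0 < t → HasDerivAt E ((1 + ε ^ 2) * (-4 * Q t) -
      2 * (1 - ε ^ 2) * (P t - Q t - 2 * G t + V t ^ 2 / (2 * π))) t := fun t ht =>
    ((hPQd t ht).const_mul _).sub ((hGd t ht).const_mul _)
  have hexp : ∀ t, HasDerivAt (fun t => Real.exp (2 * (1 - ε) * t))
      (Real.exp (2 * (1 - ε) * t) * (2 * (1 - ε))) t := fun t => by
    simpa using ((hasDerivAt_id t).const_mul (2 * (1 - ε))).exp
  have hEc : Continuous E := by fun_prop
  have hanti : AntitoneOn (fun t => E t * Real.exp (2 * (1 - ε) * t)) (Set.Ici 0) := by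
    refine antitoneOn_of_deriv_nonpos (convex_Ici 0) (by fun_prop) ?_ ?_
    · rw [interior_Ici]
      exact fun t ht => ((hEd t ht).mul (hexp t)).differentiableAt.differentiableWithinAt
    · rw [interior_Ici]
      intro t ht
      have ht' : 0 < t := ht
      have hd := ((hEd t ht).mul (hexp t)).deriv
      refine hd.trans_le ?_
      have hy := hyoung t ht'.le (1 - ε) (1 + ε)
      have hVn : 0 ≤ (1 - ε ^ 2) * (V t ^ 2 / (2 * π)) :=
        mul_nonneg (by nlinarith) (by positivity)
      have hkey : (1 + ε ^ 2) * (-4 * Q t) -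
          2 * (1 - ε ^ 2) * (P t - Q t - 2 * G t + V t ^ 2 / (2 * π)) + E t * (2 * (1 - ε)) ≤ 0 := by
        simp only [hE]
        nlinarith [mul_nonneg hε0.le hy]
      have := mul_nonpos_of_nonpos_of_nonneg hkey (Real.exp_pos (2 * (1 - ε) * t)).le
      linarith
  have hdecay := hanti Set.self_mem_Ici (Set.mem_Ici.2 ht) ht
  simp only [mul_zero, Real.exp_zero, mul_one] at hdecay
  have hupper : E 0 ≤ 2 * (P 0 + Q 0) := by
    simp only [hE]
    nlinarith [mul_nonneg (by nlinarith : 0 ≤ 1 - ε ^ 2) (hyoung 0 le_rfl 1 (-1))]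
  have hlower : 2 * (ε ^ 2 * (P t + Q t)) ≤ E t := by
    simp only [hE]
    nlinarith [mul_nonneg (by nlinarith : 0 ≤ 1 - ε ^ 2) (hyoung t ht 1 1)]
  rw [Real.exp_neg, ← div_eq_mul_inv, le_div_iff₀ (Real.exp_pos _)]
  have := mul_le_mul_of_nonneg_right hlower (Real.exp_pos (2 * (1 - ε) * t)).le
  linarith

/-- Partial derivatives of a function that is `C¹` on the closed half-plane. -/
theorem exists_partial_derivs_of_contDiffOn {u : ℝ → ℝ → ℝ}
    (hu : ContDiffOn ℝ 1 (Function.uncurry u) (Set.Ici (0:ℝ) ×ˢ Set.univ)) :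
    (∀ t, 0 < t → ∀ x, HasDerivAt (u t) (deriv (u t) x) x) ∧
    (∀ t, 0 < t → ∀ x, HasDerivAt (fun s => u s x) (deriv (fun s => u s x) t) t) ∧
    ContinuousOn (Function.uncurry fun t x => deriv (u t) x) (Set.Ioi 0 ×ˢ Set.univ) := by
  have hopen : IsOpen (Set.Ioi (0:ℝ) ×ˢ (Set.univ : Set ℝ)) := isOpen_Ioi.prod isOpen_univ
  have hu' : ContDiffOn ℝ 1 (Function.uncurry u) (Set.Ioi (0:ℝ) ×ˢ Set.univ) :=
    hu.mono (Set.prod_mono Set.Ioi_subset_Ici_self le_rfl)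
  have hfd : ∀ t, 0 < t → ∀ x, HasFDerivAt (Function.uncurry u)
      (fderiv ℝ (Function.uncurry u) (t, x)) (t, x) := fun t ht x =>
    ((hu'.differentiableOn one_ne_zero).differentiableAt
      (hopen.mem_nhds ⟨Set.mem_Ioi.2 ht, trivial⟩)).hasFDerivAt
  have hx : ∀ t, 0 < t → ∀ x,
      HasDerivAt (u t) (fderiv ℝ (Function.uncurry u) (t, x) (0, 1)) x := fun t ht x =>
    (hfd t ht x).comp_hasDerivAt x ((hasDerivAt_const x t).prodMk (hasDerivAt_id x))
  refine ⟨fun t ht x => (hx t ht x).differentiableAt.hasDerivAt, fun t ht x => ?_, ?_⟩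
  · have := (hfd t ht x).comp_hasDerivAt t ((hasDerivAt_id t).prodMk (hasDerivAt_const t x))
    exact this.differentiableAt.hasDerivAt
  · refine ((hu'.continuousOn_fderiv_of_isOpen hopen le_rfl).clm_apply
      (continuousOn_const (c := ((0:ℝ), (1:ℝ))))).congr ?_
    rintro ⟨t, x⟩ ⟨ht, -⟩
    exact (hx t ht x).deriv

/-- Extending a function on the closed half-plane by its boundary values gives a continuous
function. -/
theorem continuous_uncurry_max_zero {u : ℝ → ℝ → ℝ}
    (hu : ContinuousOn (Function.uncurry u) (Set.Ici (0:ℝ) ×ˢ Set.univ)) :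
    Continuous (Function.uncurry fun t x => u (max t 0) x) :=
  hu.comp_continuous (f := fun p : ℝ × ℝ => (max p.1 0, p.2)) (by fun_prop)
    fun p => ⟨Set.mem_Ici.2 (le_max_right _ _), trivial⟩

/-- Parallelogram identity relating `f₊, f₋` to the macroscopic variables. -/
theorem nsq_half_add_add_nsq_half_sub {f g : ℝ → ℝ} (hf : Continuous f) (hg : Continuous g)
    (m : ℝ) :
    nsq (fun x => (f x + g x) / 2 - m / 2) + nsq (fun x => (f x - g x) / 2 - m / 2) =
      (1 / (4 * π)) * ((∫ x in (0:ℝ)..(2 * π), (f x - m) ^ 2) +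
        ∫ x in (0:ℝ)..(2 * π), g x ^ 2) := by
  unfold nsq
  rw [← mul_add, ← intervalIntegral.integral_add (Continuous.intervalIntegrable (by fun_prop) _ _)
      (Continuous.intervalIntegrable (by fun_prop) _ _),
    ← intervalIntegral.integral_add (Continuous.intervalIntegrable (by fun_prop) _ _)
      (Continuous.intervalIntegrable (by fun_prop) _ _),
    ← intervalIntegral.integral_const_mul, ← intervalIntegral.integral_const_mul]
  refine intervalIntegral.integral_congr fun x _ => ?_
  simp only
  field_simp
  ring

/-- Theorem 1.1 (a), L² decay of f± for constant σ = 2 (defective case). -/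
theorem gt_constant_L2_decay_sigma_two
    (u v : ℝ → ℝ → ℝ) (u₀ v₀ : ℝ → ℝ)
    (huC : ContDiffOn ℝ 1 (Function.uncurry u) (Set.Ici (0:ℝ) ×ˢ Set.univ))
    (hvC : ContDiffOn ℝ 1 (Function.uncurry v) (Set.Ici (0:ℝ) ×ˢ Set.univ))
    (hup : ∀ t, Function.Periodic (u t) (2 * π))
    (hvp : ∀ t, Function.Periodic (v t) (2 * π))
    (hpde1 : ∀ t, 0 < t → ∀ x, deriv (fun s => u s x) t + deriv (fun y => v t y) x = 0)
    (hpde2 : ∀ t, 0 < t → ∀ x,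
      deriv (fun s => v s x) t + deriv (fun y => u t y) x = -2 * v t x)
    (hu0 : ∀ x, u 0 x = u₀ x) (hv0 : ∀ x, v 0 x = v₀ x) :
    ∀ ε : ℝ, 0 < ε → ε < 1 → ∀ t, 0 ≤ t →
      Real.sqrt (nsq (fun x => (u t x + v t x) / 2 - havg u₀ / 2) +
          nsq (fun x => (u t x - v t x) / 2 - havg u₀ / 2)) ≤
        (Real.sqrt 2 / ε) *
          Real.sqrt (nsq (fun x => (u₀ x + v₀ x) / 2 - havg u₀ / 2) +
            nsq (fun x => (u₀ x - v₀ x) / 2 - havg u₀ / 2)) *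
          Real.exp (-(1 - ε) * t) := by
  intro ε hε0 hε1 t ht
  obtain rfl : u 0 = u₀ := funext hu0
  obtain rfl : v 0 = v₀ := funext hv0
  obtain ⟨hux, hut, hua⟩ := exists_partial_derivs_of_contDiffOn huC
  obtain ⟨hvx, hvt, hvb⟩ := exists_partial_derivs_of_contDiffOn hvC
  have hUc := continuous_uncurry_max_zero huC.continuousOn
  have hVc := continuous_uncurry_max_zero hvC.continuousOn
  have huc : ∀ s, 0 ≤ s → Continuous (u s) := fun s hs => by
    simpa [max_eq_left hs, Function.comp_def] using hUc.comp (Continuous.prodMk_right s)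
  have hvc : ∀ s, 0 ≤ s → Continuous (v s) := fun s hs => by
    simpa [max_eq_left hs, Function.comp_def] using hVc.comp (Continuous.prodMk_right s)
  set m := havg (u 0) with hm
  have hmax : ∀ s : ℝ, 0 < s → (fun r : ℝ => max r 0) =ᶠ[nhds s] id := fun s hs => by
    filter_upwards [Ioi_mem_nhds hs] with r hr using max_eq_left (le_of_lt hr)
  have key := goldsteinTaylor_energy_decay (w := fun s x => u (max s 0) x - m)
    (v := fun s x => v (max s 0) x) (a := fun s x => deriv (u s) x)
    (b := fun s x => deriv (v s) x) (hUc.sub continuous_const) hVc hua hvb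
    (fun s hs x => by simpa [max_eq_left hs.le] using hux s hs x)
    (fun s hs x => by simpa [max_eq_left hs.le] using hvx s hs x)
    (fun s hs x => by
      have h := hut s hs x
      rw [eq_neg_of_add_eq_zero_left (hpde1 s hs x)] at h
      refine (h.sub_const m).congr_of_eventuallyEq ?_
      filter_upwards [hmax s hs] with r hr
      simp [hr])
    (fun s hs x => by
      have h := hvt s hs x
      rw [show deriv (fun s => v s x) s = -deriv (u s) x - 2 * v (max s 0) x by
        have := hpde2 s hs x
        rw [max_eq_left hs.le]
        linarith] at h
      refine h.congr_of_eventuallyEq ?_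
      filter_upwards [hmax s hs] with r hr
      simp [hr])
    (fun s => by simpa using hup (max s 0) 0)
    (fun s => by simpa using hvp (max s 0) 0)
    (by
      simp only [max_self]
      rw [intervalIntegral.integral_sub ((huc 0 le_rfl).intervalIntegrable _ _) (by simp)]
      simp only [hm, havg, intervalIntegral.integral_const, smul_eq_mul]
      field_simp
      ring)
    hε0 hε1 ht
  simp only [max_eq_left ht, max_self] at key
  rw [nsq_half_add_add_nsq_half_sub (huc t ht) (hvc t ht),
    nsq_half_add_add_nsq_half_sub (huc 0 le_rfl) (hvc 0 le_rfl)]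
  set N := (∫ x in (0:ℝ)..(2 * π), (u t x - m) ^ 2) + ∫ x in (0:ℝ)..(2 * π), v t x ^ 2
  set N₀ := (∫ x in (0:ℝ)..(2 * π), (u 0 x - m) ^ 2) + ∫ x in (0:ℝ)..(2 * π), v 0 x ^ 2
  have hN₀ : 0 ≤ N₀ := add_nonneg
    (intervalIntegral.integral_nonneg (by positivity) fun x _ => sq_nonneg _)
    (intervalIntegral.integral_nonneg (by positivity) fun x _ => sq_nonneg _)
  rw [Real.sqrt_le_left (by positivity), mul_pow, mul_pow, div_pow, Real.sq_sqrt (by norm_num),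
    Real.sq_sqrt (by positivity), ← Real.exp_nat_mul]
  have hexp : ((2:ℕ):ℝ) * (-(1 - ε) * t) = -(2 * (1 - ε) * t) := by push_cast; ring
  rw [hexp]
  have hpos : 0 ≤ N₀ * Real.exp (-(2 * (1 - ε) * t)) := by positivity
  calc 1 / (4 * π) * N = 1 / (4 * π) * (1 / ε ^ 2 * (ε ^ 2 * N)) := by field_simp
    _ ≤ 1 / (4 * π) * (1 / ε ^ 2 * (2 * (N₀ * Real.exp (-(2 * (1 - ε) * t))))) := by
      refine mul_le_mul_of_nonneg_left (mul_le_mul_of_nonneg_left ?_ ?_) ?_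
      · linarith
      · positivity
      · positivity
    _ = 2 / ε ^ 2 * (1 / (4 * π) * N₀) * Real.exp (-(2 * (1 - ε) * t)) := by ring
end
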